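/- Let n ∈ ℕ with √d·2^{-n} < T, let S : [0,T] → (0,∞)^d be càdlàg, continuous at t = T, with S(0) = (1,…,1), and let Π̂(S) be the discretized piecewise-constant path built from S. Suppose G : D([0,T];ℝ^d) → ℝ satisfies |G(ω) − G(ω̃)| ≤ m_G(d(ω,ω̃)) for all ω, ω̃, where m_G : [0,∞) → [0,∞) is nondecreasing and d is the Skorokhod distance. Then |G(S) − G(Π̂(S))| ≤ 3·m_G(3√d·2^{-n}). -/

import Mathlib

open Filter Set
open scoped Classical

noncomputable section

/-- `ℝ^d` with the Euclidean norm. -/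
abbrev E (d : ℕ) : Type := EuclideanSpace ℝ (Fin d)

/-- `f` is càdlàg on `[0,T]`: right-continuous on `[0,T)` and with left limits on `(0,T]`. -/
def IsCadlagOn (d : ℕ) (T : ℝ) (f : ℝ → E d) : Prop :=
  (∀ t ∈ Set.Ico (0:ℝ) T, Tendsto f (nhdsWithin t (Set.Ioo t T)) (nhds (f t))) ∧
  (∀ t ∈ Set.Ioc (0:ℝ) T, ∃ L, Tendsto f (nhdsWithin t (Set.Ico 0 t)) (nhds L))

/-- `f` is (left-)continuous at maturity `t = T`. -/
def ContinuousAtMaturity (d : ℕ) (T : ℝ) (f : ℝ → E d) : Prop :=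
  Tendsto f (nhdsWithin T (Set.Ico 0 T)) (nhds (f T))

/-- The Skorokhod distance on paths. -/
def skorokhodDist (d : ℕ) (T : ℝ) (ω ωt : ℝ → E d) : ℝ :=
  sInf {r : ℝ | ∃ lam : ℝ → ℝ, StrictMonoOn lam (Set.Icc 0 T) ∧
    Set.BijOn lam (Set.Icc 0 T) (Set.Icc 0 T) ∧
    ∀ t ∈ Set.Icc (0:ℝ) T, ‖ω t - ωt (lam t)‖ + |lam t - t| ≤ r}

/-- The exit times of step `δ`. -/
def exitTimes (d : ℕ) (T δ : ℝ) (f : ℝ → E d) : ℕ → ℝ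
  | 0 => 0
  | k + 1 =>
      let τk := exitTimes d T δ f k
      let S : Set ℝ := {t : ℝ | τk < t ∧ δ ≤ ‖f t - f τk‖}
      if S.Nonempty then min T (min (τk + δ) (sInf S)) else min T (τk + δ)

/-- `M = min{k : τ_k = T}`. -/
def exitCount (d : ℕ) (T δ : ℝ) (f : ℝ → E d) : ℕ :=
  sInf {k : ℕ | exitTimes d T δ f k = T}

/-- The dyadic grid set `B^{(i)}`. -/
def Bset (d i : ℕ) : Set ℝ :=
  {x | ∃ k : ℕ, 0 < k ∧ x = (k : ℝ) * (Real.sqrt d * 2 ^ (-(i : ℤ)))} ∪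
  {x | ∃ k : ℕ, 0 < k ∧ x = Real.sqrt d * 2 ^ (-(i : ℤ)) / (k : ℝ)}

/-- The deterministic grid times `τ̂_k`. -/
def gridTimes (d n : ℕ) (T : ℝ) (τ : ℕ → ℝ) (M : ℕ) : ℕ → ℝ
  | 0 => 0
  | 1 => Real.sqrt d * 2 ^ (-(n : ℤ))
  | k + 2 =>
      if k + 2 ≤ M then
        gridTimes d n T τ M (k + 1) +
          (1 - Real.sqrt d * 2 ^ (-(n : ℤ)) / T) *
            sSup {s : ℝ | s ∈ Bset d (n + (k + 2)) ∧ s < τ (k + 1) - τ k}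
      else T

/-- The dyadic rounding map `π^{(m)}(x)_i = 2^{-m}·⌈2^m x_i⌉`. -/
def dyadicRound (d m : ℕ) (x : E d) : E d :=
  WithLp.toLp 2 (fun i => (2 : ℝ) ^ (-(m : ℤ)) * ((⌈(2 : ℝ) ^ (m : ℤ) * x i⌉ : ℤ) : ℝ))

/-- The path space `D([0,T];ℝ^d)`: càdlàg paths, starting at `(1,…,1)`, continuous at `T`. -/
def DReal (d : ℕ) (T : ℝ) : Set (ℝ → E d) :=
  {f | IsCadlagOn d T f ∧ ContinuousAtMaturity d T f ∧ ∀ i, f 0 i = 1}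

/-- `Π̂(S)_t = Σ_{k=0}^{M−1} π^{(n+k)}(S_{τ_k}) 1_{[τ̂_k,τ̂_{k+1})}(t)
              + π^{(n)}(S_T) 1_{[τ̂_M,T]}(t)`. -/
def hatPi (d n : ℕ) (T : ℝ) (S : ℝ → E d) : ℝ → E d :=
  let δ := Real.sqrt d * 2 ^ (-(n : ℤ))
  let τ := exitTimes d T δ S
  let M := exitCount d T δ S
  let τh := gridTimes d n T τ M
  fun t =>
    (∑ k ∈ Finset.range M,
      Set.indicator (Set.Ico (τh k) (τh (k + 1))) (fun _ => dyadicRound d (n + k) (S (τ k))) t)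
    + Set.indicator (Set.Icc (τh M) T) (fun _ => dyadicRound d n (S T)) t

/-! ### Exit times -/

lemma exit_succ_props (d : ℕ) (T δ : ℝ) (hδ : 0 < δ) (f : ℝ → E d) (hf : IsCadlagOn d T f)
    (k : ℕ) (h0 : 0 ≤ exitTimes d T δ f k) (hk : exitTimes d T δ f k < T) :
    exitTimes d T δ f k < exitTimes d T δ f (k + 1) ∧
    exitTimes d T δ f (k + 1) ≤ T ∧
    exitTimes d T δ f (k + 1) ≤ exitTimes d T δ f k + δ ∧
    (∀ t ∈ Set.Ico (exitTimes d T δ f k) (exitTimes d T δ f (k + 1)),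
      ‖f t - f (exitTimes d T δ f k)‖ < δ) ∧
    (exitTimes d T δ f (k + 1) < T → exitTimes d T δ f (k + 1) < exitTimes d T δ f k + δ →
      δ ≤ ‖f (exitTimes d T δ f (k + 1)) - f (exitTimes d T δ f k)‖) := by
  have hy : exitTimes d T δ f (k + 1) =
      if {t : ℝ | exitTimes d T δ f k < t ∧ δ ≤ ‖f t - f (exitTimes d T δ f k)‖}.Nonempty then
        min T (min (exitTimes d T δ f k + δ)
          (sInf {t : ℝ | exitTimes d T δ f k < t ∧ δ ≤ ‖f t - f (exitTimes d T δ f k)‖}))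
      else min T (exitTimes d T δ f k + δ) := by
    rw [exitTimes]
  generalize exitTimes d T δ f (k + 1) = y at *
  generalize exitTimes d T δ f k = x at *
  set A : Set ℝ := {t : ℝ | x < t ∧ δ ≤ ‖f t - f x‖} with hA
  have hbdd : BddBelow A := ⟨x, fun t ht => ht.1.le⟩
  by_cases hne : A.Nonempty
  · rw [if_pos hne] at hy
    have hxA : x < sInf A := by
      have h1 := hf.1 x ⟨h0, hk⟩
      have h2 : ∀ᶠ t in nhdsWithin x (Set.Ioo x T), ‖f t - f x‖ < δ := by
        have := h1.eventually (Metric.ball_mem_nhds (f x) hδ)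
        simpa [dist_eq_norm] using this
      rw [nhdsWithin_Ioo_eq_nhdsGT hk] at h2
      obtain ⟨u, hu, hsub⟩ := mem_nhdsGT_iff_exists_Ioo_subset.1 h2
      refine lt_of_lt_of_le hu (le_csInf hne ?_)
      intro t ht
      by_contra hlt
      have : ‖f t - f x‖ < δ := hsub ⟨ht.1, not_le.1 hlt⟩
      exact absurd ht.2 (not_le.2 this)
    refine ⟨?_, ?_, ?_, ?_, ?_⟩
    · rw [hy]; exact lt_min hk (lt_min (by linarith) hxA)
    · rw [hy]; exact min_le_left _ _
    · rw [hy]; exact (min_le_right _ _).trans (min_le_left _ _)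
    · intro t ht
      rcases eq_or_lt_of_le ht.1 with h | h
      · subst h; simpa using hδ
      · by_contra hcon
        have : sInf A ≤ t := csInf_le hbdd ⟨h, not_lt.1 hcon⟩
        have h3 : y ≤ sInf A := by rw [hy]; exact (min_le_right _ _).trans (min_le_right _ _)
        exact absurd ht.2 (not_lt.2 (h3.trans this))
    · intro hyT hyx
      have hys : y = sInf A := by
        rcases min_choice T (min (x + δ) (sInf A)) with h | h
        · rw [h] at hy; linarith
        · rw [h] at hy
          rcases min_choice (x + δ) (sInf A) with h' | h'
          · rw [h'] at hy; linarith
          · rw [h'] at hy; exact hy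
      by_contra hcon
      rw [not_le] at hcon
      have hy0 : 0 ≤ y := by rw [hys]; linarith
      have h1 := hf.1 y ⟨hy0, hyT⟩
      have h2 : ∀ᶠ t in nhdsWithin y (Set.Ioo y T), ‖f t - f x‖ < δ :=
        ((h1.sub_const (f x)).norm).eventually_lt_const hcon
      rw [nhdsWithin_Ioo_eq_nhdsGT hyT] at h2
      obtain ⟨u, hu, hsub⟩ := mem_nhdsGT_iff_exists_Ioo_subset.1 h2
      have : u ≤ sInf A := by
        refine le_csInf hne ?_
        intro t ht
        by_contra hlt
        have hyt : y ≤ t := by rw [hys]; exact csInf_le hbdd ht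
        rcases eq_or_lt_of_le hyt with h | h
        · rw [← h] at ht; exact absurd ht.2 (not_le.2 hcon)
        · have : ‖f t - f x‖ < δ := hsub ⟨h, not_le.1 hlt⟩
          exact absurd ht.2 (not_le.2 this)
      rw [← hys] at this
      exact absurd hu (not_lt.2 this)
  · rw [if_neg hne] at hy
    refine ⟨?_, ?_, ?_, ?_, ?_⟩
    · rw [hy]; exact lt_min hk (by linarith)
    · rw [hy]; exact min_le_left _ _
    · rw [hy]; exact min_le_right _ _
    · intro t ht
      rcases eq_or_lt_of_le ht.1 with h | h
      · subst h; simpa using hδ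
      · by_contra hcon
        exact hne ⟨t, h, not_lt.1 hcon⟩
    · intro hyT hyx
      rcases min_choice T (x + δ) with h | h
      · rw [h] at hy; linarith
      · rw [h] at hy; linarith

lemma exit_exists (d : ℕ) (T δ : ℝ) (hT : 0 < T) (hδ : 0 < δ) (f : ℝ → E d)
    (hf : IsCadlagOn d T f) : ∃ k, exitTimes d T δ f k = T := by
  by_contra hcon
  push Not at hcon
  have key : ∀ k, 0 ≤ exitTimes d T δ f k ∧ exitTimes d T δ f k < T := by
    intro k
    induction k with
    | zero => exact ⟨by simp [exitTimes], by simpa [exitTimes] using hT⟩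
    | succ k ih =>
      have h := exit_succ_props d T δ hδ f hf k ih.1 ih.2
      exact ⟨ih.1.trans h.1.le, lt_of_le_of_ne h.2.1 (hcon _)⟩
  have hmono : StrictMono (exitTimes d T δ f) :=
    strictMono_nat_of_lt_succ fun k => (exit_succ_props d T δ hδ f hf k (key k).1 (key k).2).1
  have hbdd : BddAbove (Set.range (exitTimes d T δ f)) :=
    ⟨T, by rintro _ ⟨k, rfl⟩; exact (key k).2.le⟩
  have hlim := tendsto_atTop_ciSup hmono.monotone hbdd
  set s := ⨆ i, exitTimes d T δ f i with hs
  have hlt : ∀ k, exitTimes d T δ f k < s := fun k =>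
    lt_of_lt_of_le (hmono (Nat.lt_succ_self k)) (le_ciSup hbdd (k + 1))
  have hsT : s ≤ T := ciSup_le fun k => (key k).2.le
  have hs0 : 0 < s := lt_of_le_of_lt (key 0).1 (hlt 0)
  obtain ⟨L, hL⟩ := hf.2 s ⟨hs0, hsT⟩
  have hlim' : Tendsto (exitTimes d T δ f) atTop (nhdsWithin s (Set.Ico 0 s)) :=
    tendsto_nhdsWithin_iff.2 ⟨hlim, Eventually.of_forall fun k => ⟨(key k).1, hlt k⟩⟩
  have hfl := hL.comp hlim'
  have hfl' := hfl.comp (tendsto_add_atTop_nat 1)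
  have hd0 := (hfl'.sub hfl).norm
  simp only [sub_self, norm_zero] at hd0
  have ht0 := (hlim.comp (tendsto_add_atTop_nat 1)).sub hlim
  simp only [sub_self] at ht0
  obtain ⟨k, hk1, hk2⟩ := ((hd0.eventually_lt_const hδ).and (ht0.eventually_lt_const hδ)).exists
  simp only [Function.comp] at hk1 hk2
  have h := exit_succ_props d T δ hδ f hf k (key k).1 (key k).2
  have := h.2.2.2.2 (key (k + 1)).2 (by linarith)
  linarith

/-- The package of properties of the exit times. -/
lemma exit_package (d : ℕ) (T δ : ℝ) (hT : 0 < T) (hδ : 0 < δ) (hδT : δ < T) (f : ℝ → E d)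
    (hf : IsCadlagOn d T f) (hc : ContinuousAtMaturity d T f) :
    ∃ m : ℕ, exitCount d T δ f = m + 2 ∧ exitTimes d T δ f (m + 2) = T ∧
      (∀ k < m + 2, exitTimes d T δ f k < exitTimes d T δ f (k + 1)) ∧
      (∀ k < m + 2, exitTimes d T δ f (k + 1) ≤ exitTimes d T δ f k + δ) ∧
      (∀ k < m + 2, ∀ t ∈ Set.Ico (exitTimes d T δ f k) (exitTimes d T δ f (k + 1)),
        ‖f t - f (exitTimes d T δ f k)‖ < δ) ∧
      ‖f T - f (exitTimes d T δ f (m + 1))‖ ≤ δ := by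
  have hne : {k : ℕ | exitTimes d T δ f k = T}.Nonempty := exit_exists d T δ hT hδ f hf
  have hM : exitTimes d T δ f (exitCount d T δ f) = T := Nat.sInf_mem hne
  have hmin : ∀ k < exitCount d T δ f, exitTimes d T δ f k ≠ T :=
    fun k hk h => Nat.notMem_of_lt_sInf hk h
  have key : ∀ k < exitCount d T δ f, 0 ≤ exitTimes d T δ f k ∧ exitTimes d T δ f k < T := by
    intro k
    induction k with
    | zero => exact fun _ => ⟨by simp [exitTimes], by simpa [exitTimes] using hT⟩
    | succ k ih =>
      intro hk
      have ih := ih (by omega)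
      have h := exit_succ_props d T δ hδ f hf k ih.1 ih.2
      exact ⟨ih.1.trans h.1.le, lt_of_le_of_ne h.2.1 (hmin _ hk)⟩
  have h00 : exitTimes d T δ f 0 = 0 := by simp [exitTimes]
  have hne0 : exitCount d T δ f ≠ 0 := by
    intro h; rw [h, h00] at hM; linarith
  have hne1 : exitCount d T δ f ≠ 1 := by
    intro h
    have h1 := exit_succ_props d T δ hδ f hf 0 (key 0 (by omega)).1 (key 0 (by omega)).2
    rw [h] at hM
    have := h1.2.2.1
    rw [h00] at this
    simp only [zero_add] at this
    linarith
  obtain ⟨m, hm⟩ : ∃ m, exitCount d T δ f = m + 2 := ⟨exitCount d T δ f - 2, by omega⟩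
  rw [hm] at key hM
  have hP := fun k (hk : k < m + 2) => exit_succ_props d T δ hδ f hf k (key k hk).1 (key k hk).2
  refine ⟨m, hm, hM, fun k hk => (hP k hk).1, fun k hk => (hP k hk).2.2.1,
    fun k hk => (hP k hk).2.2.2.1, ?_⟩
  have hk := key (m + 1) (by omega)
  have h4 := (hP (m + 1) (by omega)).2.2.2.1
  have hM' : exitTimes d T δ f (m + 1 + 1) = T := hM
  rw [hM'] at h4
  have hlim : Tendsto (fun t => ‖f t - f (exitTimes d T δ f (m + 1))‖)
      (nhdsWithin T (Set.Ico 0 T)) (nhds ‖f T - f (exitTimes d T δ f (m + 1))‖) :=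
    (Tendsto.sub_const hc _).norm
  rw [nhdsWithin_Ico_eq_nhdsLT hT] at hlim
  refine le_of_tendsto hlim ?_
  filter_upwards [Ico_mem_nhdsLT hk.2] with t ht
  exact (h4 t ht).le

/-! ### Grid times -/

lemma Bsup_props (d i : ℕ) (hd : 1 ≤ d) (Δ : ℝ) (hΔ : 0 < Δ) :
    0 < sSup {s : ℝ | s ∈ Bset d i ∧ s < Δ} ∧ sSup {s : ℝ | s ∈ Bset d i ∧ s < Δ} ≤ Δ ∧
    Δ - Real.sqrt d * 2 ^ (-(i : ℤ)) ≤ sSup {s : ℝ | s ∈ Bset d i ∧ s < Δ} := by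
  have hε : 0 < Real.sqrt d * 2 ^ (-(i : ℤ)) := by
    have : (0:ℝ) < d := by exact_mod_cast hd
    positivity
  have hbdd : BddAbove {s : ℝ | s ∈ Bset d i ∧ s < Δ} := ⟨Δ, fun s hs => hs.2.le⟩
  unfold Bset at *
  generalize Real.sqrt d * 2 ^ (-(i : ℤ)) = ε at *
  obtain ⟨N, hN⟩ := exists_nat_gt (ε / Δ)
  have hNpos : 0 < (N : ℝ) := lt_of_le_of_lt (by positivity) hN
  have hmem : ε / N ∈ {s : ℝ | s ∈ {x | ∃ k : ℕ, 0 < k ∧ x = (k : ℝ) * ε} ∪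
      {x | ∃ k : ℕ, 0 < k ∧ x = ε / (k : ℝ)} ∧ s < Δ} := by
    refine ⟨Or.inr ⟨N, by exact_mod_cast hNpos, rfl⟩, ?_⟩
    rw [div_lt_iff₀ hΔ] at hN
    rw [div_lt_iff₀ hNpos]; linarith
  have hpos := lt_of_lt_of_le (show 0 < ε / N by positivity) (le_csSup hbdd hmem)
  refine ⟨hpos, csSup_le ⟨_, hmem⟩ fun s hs => hs.2.le, ?_⟩
  rcases le_or_gt Δ ε with h | h
  · linarith
  · have h1 : 1 < Δ / ε := by rwa [lt_div_iff₀ hε, one_mul]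
    have hc1 : 1 < ⌈Δ / ε⌉₊ := by rw [Nat.lt_ceil]; simpa using h1
    obtain ⟨j, hj⟩ : ∃ j, ⌈Δ / ε⌉₊ = j + 1 := ⟨⌈Δ / ε⌉₊ - 1, by omega⟩
    have hlt : (j : ℝ) < Δ / ε := by rw [← Nat.lt_ceil]; omega
    have hle : Δ / ε ≤ (j : ℝ) + 1 := by
      have := Nat.le_ceil (Δ / ε); rw [hj] at this; exact_mod_cast this
    rw [lt_div_iff₀ hε] at hlt
    rw [div_le_iff₀ hε] at hle
    have := le_csSup hbdd (show (j : ℝ) * ε ∈ _ from ⟨Or.inl ⟨j, by omega, rfl⟩, hlt⟩)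
    nlinarith

lemma grid_package (d n m : ℕ) (hd : 1 ≤ d) (T : ℝ) (hT : 0 < T)
    (hδT : Real.sqrt d * 2 ^ (-(n : ℤ)) < T) (τ : ℕ → ℝ) (h0 : τ 0 = 0) (hTm : τ (m + 2) = T)
    (hlt : ∀ k < m + 2, τ k < τ (k + 1))
    (hle : ∀ k < m + 2, τ (k + 1) ≤ τ k + Real.sqrt d * 2 ^ (-(n : ℤ))) :
    gridTimes d n T τ (m + 2) 0 = 0 ∧ gridTimes d n T τ (m + 2) (m + 3) = T ∧
    (∀ k < m + 3, gridTimes d n T τ (m + 2) k < gridTimes d n T τ (m + 2) (k + 1)) ∧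
    (∀ k < m + 2, |gridTimes d n T τ (m + 2) k - τ k| ≤
      3 / 2 * (Real.sqrt d * 2 ^ (-(n : ℤ)))) := by
  have hδ : 0 < Real.sqrt d * 2 ^ (-(n : ℤ)) := by
    have : (0:ℝ) < d := by exact_mod_cast hd
    positivity
  set δ := Real.sqrt d * 2 ^ (-(n : ℤ)) with hδdef
  have hg0 : gridTimes d n T τ (m + 2) 0 = 0 := by rw [gridTimes]
  have hg1 : gridTimes d n T τ (m + 2) 1 = δ := by rw [gridTimes]
  have hgT : gridTimes d n T τ (m + 2) (m + 3) = T := by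
    rw [gridTimes, if_neg (by omega)]
  have hgs : ∀ k < m + 1, gridTimes d n T τ (m + 2) (k + 2) = gridTimes d n T τ (m + 2) (k + 1) +
      (1 - δ / T) * sSup {s : ℝ | s ∈ Bset d (n + (k + 2)) ∧ s < τ (k + 1) - τ k} := by
    intro k hk
    rw [gridTimes, if_pos (by omega)]
  have hB := fun k (hk : k < m + 1) =>
    Bsup_props d (n + (k + 2)) hd (τ (k + 1) - τ k) (by have := hlt k (by omega); linarith)
  have hc0 : 0 < 1 - δ / T := by
    have : δ / T < 1 := by rwa [div_lt_one hT]
    linarith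
  have hc1 : 1 - δ / T ≤ 1 := by
    have : 0 ≤ δ / T := by positivity
    linarith
  have hpow : ∀ k : ℕ, Real.sqrt d * 2 ^ (-((n + (k + 2) : ℕ) : ℤ)) = δ * (1 / 2) ^ (k + 2) := by
    intro k
    rw [hδdef]
    push_cast
    rw [neg_add, zpow_add₀ (by norm_num), mul_assoc]
    congr 2
    rw [zpow_neg, one_div, inv_pow]
    norm_cast
  have hcT : (1 - δ / T) * T = T - δ := by field_simp
  generalize hc : 1 - δ / T = c at *
  have hub : ∀ k < m + 2, gridTimes d n T τ (m + 2) (k + 1) ≤ δ + c * τ k ∧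
      δ + c * τ k - δ * (1 / 2 - (1 / 2) ^ (k + 1)) ≤ gridTimes d n T τ (m + 2) (k + 1) := by
    intro k
    induction k with
    | zero => intro _; simp only [zero_add, hg1, h0]; constructor <;> norm_num
    | succ k ih =>
      intro hk
      have ih := ih (by omega)
      obtain ⟨b0, b1, b2⟩ := hB k (by omega)
      rw [hgs k (by omega)]
      rw [hpow k] at b2
      generalize sSup {s : ℝ | s ∈ Bset d (n + (k + 2)) ∧ s < τ (k + 1) - τ k} = b at *
      have e1 : c * b ≤ c * (τ (k + 1) - τ k) := mul_le_mul_of_nonneg_left b1 hc0.le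
      have e2 : c * (τ (k + 1) - τ k - δ * (1 / 2) ^ (k + 2)) ≤ c * b :=
        mul_le_mul_of_nonneg_left b2 hc0.le
      have e3 : c * (δ * (1 / 2) ^ (k + 2)) ≤ δ * (1 / 2) ^ (k + 2) :=
        mul_le_of_le_one_left (by positivity) hc1
      have e4 : ((1:ℝ) / 2) ^ (k + 1) = 2 * (1 / 2) ^ (k + 2) := by ring
      have e5 : ((1:ℝ) / 2) ^ (k + 1 + 1) = (1 / 2) ^ (k + 2) := rfl
      rw [e4] at ih
      rw [e5]
      constructor <;> nlinarith
  have hτ : ∀ k < m + 2, 0 ≤ τ k ∧ τ k < T := by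
    have hmon : ∀ j k, k ≤ m + 2 → j ≤ k → τ j ≤ τ k := by
      intro j k hk hjk
      induction k, hjk using Nat.le_induction with
      | base => exact le_rfl
      | succ k hjk ih => exact (ih (by omega)).trans (hlt k (by omega)).le
    intro k hk
    refine ⟨h0 ▸ hmon 0 k hk.le (Nat.zero_le _), ?_⟩
    rw [← hTm]
    exact (hlt k hk).trans_le (hmon (k + 1) (m + 2) le_rfl hk)
  refine ⟨hg0, hgT, ?_, ?_⟩
  · intro k hk
    rcases k with _ | k
    · rw [hg0, zero_add, hg1]; exact hδ
    · rcases Nat.lt_or_ge k (m + 1) with h | h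
      · rw [hgs k h]
        have := mul_pos hc0 (hB k h).1
        linarith
      · obtain rfl : k = m + 1 := by omega
        rw [show m + 1 + 1 + 1 = m + 3 from rfl, hgT]
        have h1 := (hub (m + 1) (by omega)).1
        have h2 := mul_lt_mul_of_pos_left (hτ (m + 1) (by omega)).2 hc0
        linarith
  · intro k hk
    rcases k with _ | k
    · rw [hg0, h0]; simp; positivity
    · have h1 := hub k (by omega)
      have h2 := hle k (by omega)
      have h3 := hlt k (by omega)
      have h4 := hτ k (by omega)
      have h5 : c * τ k ≤ τ k := mul_le_of_le_one_left h4.1 hc1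
      have h6 : (1 - c) * τ k ≤ (1 - c) * T := mul_le_mul_of_nonneg_left h4.2.le (by linarith)
      have h7 : 0 ≤ δ * (1 / 2) ^ (k + 1) := by positivity
      rw [abs_le]
      constructor <;> nlinarith

/-! ### Time change -/

lemma time_change (m : ℕ) (a b : ℕ → ℝ) (C : ℝ)
    (ha : ∀ k < m, a k < a (k + 1)) (hb : ∀ k < m, b k < b (k + 1))
    (hC : ∀ k ≤ m, |b k - a k| ≤ C) :
    ∃ l : ℝ → ℝ, Continuous l ∧ StrictMono l ∧ (∀ k ≤ m, l (a k) = b k) ∧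
      ∀ t ∈ Set.Icc (a 0) (a m), |l t - t| ≤ C := by
  have hmon : ∀ j k, k ≤ m → j ≤ k → a j ≤ a k := by
    intro j k hk hjk
    induction k, hjk using Nat.le_induction with
    | base => exact le_rfl
    | succ k hjk ih => exact (ih (by omega)).trans (ha k (by omega)).le
  induction m with
  | zero =>
    refine ⟨fun t => t - a 0 + b 0, by fun_prop, fun x y h => by simpa using h, ?_, ?_⟩
    · intro k hk
      obtain rfl : k = 0 := by omega
      simp
    · intro t ht
      have := hC 0 le_rfl
      rwa [show t - a 0 + b 0 - t = b 0 - a 0 by ring]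
  | succ m ih =>
    obtain ⟨l, hlc, hlm, hla, hlC⟩ := ih (fun k hk => ha k (by omega)) (fun k hk => hb k (by omega))
      (fun k hk => hC k (by omega)) (fun j k hk => hmon j k (by omega))
    have ham := ha m (by omega)
    have hbm := hb m (by omega)
    obtain ⟨s, hs, hs0⟩ : ∃ s : ℝ, s * (a (m + 1) - a m) = b (m + 1) - b m ∧ 0 < s :=
      ⟨(b (m + 1) - b m) / (a (m + 1) - a m), div_mul_cancel₀ _ (by linarith),
        div_pos (by linarith) (by linarith)⟩
    refine ⟨fun t => l (min t (a m)) + s * (max t (a m) - a m), by fun_prop, ?_, ?_, ?_⟩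
    · intro x y hxy
      simp only
      rcases lt_or_ge x (a m) with h | h
      · have h1 : l (min x (a m)) < l (min y (a m)) :=
          hlm (by rw [min_eq_left h.le]; exact lt_min hxy h)
        have h2 : max x (a m) ≤ max y (a m) := max_le_max_right _ hxy.le
        nlinarith
      · rw [min_eq_right h, min_eq_right (h.trans hxy.le), max_eq_left h,
          max_eq_left (h.trans hxy.le)]
        nlinarith
    · intro k hk
      simp only
      rcases Nat.lt_or_ge m k with h | h
      · obtain rfl : k = m + 1 := by omega
        rw [min_eq_right ham.le, max_eq_left ham.le, hs, hla m le_rfl]; ring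
      · have := hmon k m (by omega) h
        rw [min_eq_left this, max_eq_right this, hla k h]; ring
    · intro t ht
      simp only
      rcases le_or_gt t (a m) with h | h
      · rw [min_eq_left h, max_eq_right h]
        have := hlC t ⟨ht.1, h⟩
        rwa [sub_self, mul_zero, add_zero]
      · rw [min_eq_right h.le, max_eq_left h.le, hla m le_rfl]
        have h1 := hC m (by omega)
        have h2 := hC (m + 1) le_rfl
        rw [abs_le] at h1 h2 ⊢
        have ht2 := ht.2
        rcases le_total s 1 with hs1 | hs1
        · have e1 : 0 ≤ (1 - s) * (t - a m) := mul_nonneg (by linarith) (by linarith)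
          have e2 : 0 ≤ (1 - s) * (a (m + 1) - t) := mul_nonneg (by linarith) (by linarith)
          constructor <;> nlinarith
        · have e1 : 0 ≤ (s - 1) * (t - a m) := mul_nonneg (by linarith) (by linarith)
          have e2 : 0 ≤ (s - 1) * (a (m + 1) - t) := mul_nonneg (by linarith) (by linarith)
          constructor <;> nlinarith

/-! ### Step paths -/

/-- A piecewise constant path with nodes `b`, values `v` and terminal value `w`. -/
def stepPath (d : ℕ) (T : ℝ) (b : ℕ → ℝ) (m : ℕ) (v : ℕ → E d) (w : E d) : ℝ → E d :=
  fun t => (∑ k ∈ Finset.range m, Set.indicator (Set.Ico (b k) (b (k + 1))) (fun _ => v k) t)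
    + Set.indicator (Set.Icc (b m) T) (fun _ => w) t

lemma node_mono (m : ℕ) (b : ℕ → ℝ) (hb : ∀ k < m, b k < b (k + 1)) :
    ∀ j k, k ≤ m → j ≤ k → b j ≤ b k := by
  intro j k hk hjk
  induction k, hjk using Nat.le_induction with
  | base => exact le_rfl
  | succ k hjk ih => exact (ih (by omega)).trans (hb k (by omega)).le

lemma stepPath_last (d : ℕ) (T : ℝ) (b : ℕ → ℝ) (m : ℕ) (v : ℕ → E d) (w : E d)
    (hb : ∀ k < m, b k < b (k + 1)) (t : ℝ) (ht : t ∈ Set.Icc (b m) T) :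
    stepPath d T b m v w t = w := by
  unfold stepPath
  rw [Finset.sum_eq_zero, Set.indicator_of_mem ht, zero_add]
  intro k hk
  rw [Finset.mem_range] at hk
  refine Set.indicator_of_notMem ?_ _
  intro h
  have := node_mono m b hb (k + 1) m le_rfl hk
  exact absurd h.2 (not_lt.2 (this.trans ht.1))

lemma stepPath_mid (d : ℕ) (T : ℝ) (b : ℕ → ℝ) (m : ℕ) (v : ℕ → E d) (w : E d)
    (hb : ∀ k < m, b k < b (k + 1)) (j : ℕ) (hj : j < m) (t : ℝ)
    (ht : t ∈ Set.Ico (b j) (b (j + 1))) :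
    stepPath d T b m v w t = v j := by
  have hmon := node_mono m b hb
  unfold stepPath
  rw [Finset.sum_eq_single j, Set.indicator_of_mem ht, Set.indicator_of_notMem, add_zero]
  · intro h
    exact absurd ht.2 (not_lt.2 ((hmon (j + 1) m le_rfl hj).trans h.1))
  · intro k hk hkj
    rw [Finset.mem_range] at hk
    refine Set.indicator_of_notMem ?_ _
    intro h
    rcases lt_or_gt_of_ne hkj with h' | h'
    · exact absurd h.2 (not_lt.2 ((hmon (k + 1) j hj.le h').trans ht.1))
    · exact absurd ht.2 (not_lt.2 ((hmon (j + 1) k hk.le h').trans h.1))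
  · intro h; exact absurd (Finset.mem_range.2 hj) h

lemma exists_piece_Ico (m : ℕ) (b : ℕ → ℝ) (t : ℝ) (h0 : b 0 ≤ t) (hm : t < b m) :
    ∃ k < m, t ∈ Set.Ico (b k) (b (k + 1)) := by
  induction m with
  | zero => linarith
  | succ m ih =>
    rcases lt_or_ge t (b m) with h | h
    · obtain ⟨k, hk, hk'⟩ := ih h
      exact ⟨k, by omega, hk'⟩
    · exact ⟨m, by omega, h, hm⟩

lemma exists_piece_Ioc (m : ℕ) (b : ℕ → ℝ) (t : ℝ) (h0 : b 0 < t) (hm : t ≤ b m) :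
    ∃ k < m, t ∈ Set.Ioc (b k) (b (k + 1)) := by
  induction m with
  | zero => linarith
  | succ m ih =>
    rcases le_or_gt t (b m) with h | h
    · obtain ⟨k, hk, hk'⟩ := ih h
      exact ⟨k, by omega, hk'⟩
    · exact ⟨m, by omega, h, hm⟩

lemma stepPath_mem (d : ℕ) (T : ℝ) (hT : 0 < T) (b : ℕ → ℝ) (m : ℕ) (hm : 0 < m)
    (v : ℕ → E d) (w : E d) (h0 : b 0 = 0) (hbT : b (m + 1) = T)
    (hb : ∀ k < m + 1, b k < b (k + 1)) (hv : ∀ i, v 0 i = 1) :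
    stepPath d T b m v w ∈ DReal d T := by
  have hb' : ∀ k < m, b k < b (k + 1) := fun k hk => hb k (by omega)
  have hconst : ∀ k < m + 1, ∃ c, ∀ t ∈ Set.Ico (b k) (b (k + 1)), stepPath d T b m v w t = c := by
    intro k hk
    rcases Nat.lt_or_ge k m with h | h
    · exact ⟨v k, fun t ht => stepPath_mid d T b m v w hb' k h t ht⟩
    · obtain rfl : k = m := by omega
      rw [hbT]
      exact ⟨w, fun t ht => stepPath_last d T b k v w hb' t ⟨ht.1, ht.2.le⟩⟩
  have hbmT : b m < T := by rw [← hbT]; exact hb m (by omega)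
  refine ⟨⟨?_, ?_⟩, ?_, ?_⟩
  · intro t ht
    obtain ⟨k, hk, hkt⟩ := exists_piece_Ico (m + 1) b t (by rw [h0]; exact ht.1)
      (by rw [hbT]; exact ht.2)
    obtain ⟨c, hc⟩ := hconst k hk
    rw [nhdsWithin_Ioo_eq_nhdsGT ht.2, hc t hkt]
    refine tendsto_const_nhds.congr' ?_
    filter_upwards [Ioo_mem_nhdsGT hkt.2] with s hs
    exact (hc s ⟨hkt.1.trans hs.1.le, hs.2⟩).symm
  · intro t ht
    obtain ⟨k, hk, hkt⟩ := exists_piece_Ioc (m + 1) b t (by rw [h0]; exact ht.1)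
      (by rw [hbT]; exact ht.2)
    obtain ⟨c, hc⟩ := hconst k hk
    refine ⟨c, ?_⟩
    rw [nhdsWithin_Ico_eq_nhdsLT ht.1]
    refine tendsto_const_nhds.congr' ?_
    filter_upwards [Ico_mem_nhdsLT hkt.1] with s hs
    exact (hc s ⟨hs.1, hs.2.trans_le hkt.2⟩).symm
  · unfold ContinuousAtMaturity
    rw [stepPath_last d T b m v w hb' T ⟨hbmT.le, le_rfl⟩, nhdsWithin_Ico_eq_nhdsLT hT]
    refine tendsto_const_nhds.congr' ?_
    filter_upwards [Ico_mem_nhdsLT hbmT] with s hs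
    exact (stepPath_last d T b m v w hb' s ⟨hs.1, hs.2.le⟩).symm
  · intro i
    rw [stepPath_mid d T b m v w hb' 0 hm 0 ⟨h0.le, by rw [← h0]; exact hb 0 (by omega)⟩]
    exact hv i

/-! ### Rounding and the Skorokhod distance -/

lemma norm_sub_dyadicRound (d m : ℕ) (x : E d) :
    ‖x - dyadicRound d m x‖ ≤ Real.sqrt d * 2 ^ (-(m : ℤ)) := by
  have hp : (0:ℝ) < 2 ^ (-(m : ℤ)) := by positivity
  have hpq : (2:ℝ) ^ (-(m : ℤ)) * 2 ^ (m : ℤ) = 1 := by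
    rw [← zpow_add₀ (by norm_num)]; simp
  rw [EuclideanSpace.norm_eq]
  have : ∀ i, ‖(x - dyadicRound d m x) i‖ ^ 2 ≤ ((2:ℝ) ^ (-(m : ℤ))) ^ 2 := by
    intro i
    have e : (x - dyadicRound d m x) i =
      x i - (2 : ℝ) ^ (-(m : ℤ)) * ((⌈(2 : ℝ) ^ (m : ℤ) * x i⌉ : ℤ) : ℝ) := rfl
    rw [e, Real.norm_eq_abs]
    have h1 := Int.le_ceil ((2 : ℝ) ^ (m : ℤ) * x i)
    have h2 := (Int.ceil_lt_add_one ((2 : ℝ) ^ (m : ℤ) * x i)).le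
    have h1' := mul_le_mul_of_nonneg_left h1 hp.le
    have h2' := mul_le_mul_of_nonneg_left h2 hp.le
    rw [← mul_assoc, hpq] at h1'
    rw [mul_add, ← mul_assoc, hpq] at h2'
    refine pow_le_pow_left₀ (abs_nonneg _) ?_ 2
    rw [abs_le]
    constructor <;> linarith
  calc √(∑ i, ‖(x - dyadicRound d m x) i‖ ^ 2) ≤ √(∑ _i : Fin d, ((2:ℝ) ^ (-(m : ℤ))) ^ 2) :=
        Real.sqrt_le_sqrt (Finset.sum_le_sum fun i _ => this i)
    _ = √d * 2 ^ (-(m : ℤ)) := by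
        rw [Finset.sum_const, Finset.card_univ, Fintype.card_fin, nsmul_eq_mul,
          Real.sqrt_mul (Nat.cast_nonneg d), Real.sqrt_sq hp.le]

lemma dyadicRound_one (d n : ℕ) (x : E d) (hx : ∀ i, x i = 1) (i : Fin d) :
    dyadicRound d n x i = 1 := by
  have e : dyadicRound d n x i =
      (2 : ℝ) ^ (-(n : ℤ)) * ((⌈(2 : ℝ) ^ (n : ℤ) * x i⌉ : ℤ) : ℝ) := rfl
  have e2 : (2 : ℝ) ^ (n : ℤ) * x i = ((2 ^ n : ℤ) : ℝ) := by rw [hx]; push_cast; simp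
  rw [e, e2, Int.ceil_intCast]
  push_cast
  rw [zpow_neg, zpow_natCast]
  exact inv_mul_cancel₀ (by positivity)

lemma skorokhod_nonneg (d : ℕ) (T : ℝ) (hT : 0 < T) (f g : ℝ → E d) :
    0 ≤ skorokhodDist d T f g := by
  refine Real.sInf_nonneg ?_
  rintro r ⟨l, _, _, h⟩
  have := h 0 ⟨le_rfl, hT.le⟩
  exact le_trans (by positivity) this

lemma skorokhod_le (d : ℕ) (T : ℝ) (hT : 0 < T) (f g : ℝ → E d) (r : ℝ) (l : ℝ → ℝ)
    (hc : Continuous l) (hl : StrictMono l) (h0 : l 0 = 0) (hlT : l T = T)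
    (h : ∀ t ∈ Set.Icc (0:ℝ) T, ‖f t - g (l t)‖ + |l t - t| ≤ r) :
    skorokhodDist d T f g ≤ r := by
  refine csInf_le ⟨0, ?_⟩ ⟨l, hl.strictMonoOn _, ⟨?_, hl.injective.injOn, ?_⟩, h⟩
  · rintro r ⟨l, _, _, h⟩
    have := h 0 ⟨le_rfl, hT.le⟩
    exact le_trans (by positivity) this
  · intro t ht
    exact ⟨h0 ▸ hl.monotone ht.1, (hl.monotone ht.2).trans hlT.le⟩
  · have := intermediate_value_Icc hT.le hc.continuousOn
    rwa [h0, hlT] at this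

/-- if `G` admits the nondecreasing modulus of continuity `m_G` with
respect to the Skorokhod distance on `D([0,T];ℝ^d)`, then
`|G(S) − G(Π̂(S))| ≤ 3·m_G(3√d·2^{-n})`. -/
theorem statement5 (d n : ℕ) (hd : 1 ≤ d) (T : ℝ) (hT : 0 < T)
    (hδT : Real.sqrt d * 2 ^ (-(n : ℤ)) < T)
    (S : ℝ → E d) (hS : IsCadlagOn d T S) (hScont : ContinuousAtMaturity d T S)
    (hS0 : ∀ i, S 0 i = 1)
    (hSpos : ∀ t ∈ Set.Icc (0:ℝ) T, ∀ i, 0 < S t i)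
    (G : (ℝ → E d) → ℝ) (mG : ℝ → ℝ)
    (hmGnonneg : ∀ r, 0 ≤ mG r) (hmGmono : MonotoneOn mG (Set.Ici 0))
    (hGmod : ∀ ω ωt : ℝ → E d, ω ∈ DReal d T → ωt ∈ DReal d T →
      |G ω - G ωt| ≤ mG (skorokhodDist d T ω ωt)) :
    |G S - G (hatPi d n T S)| ≤ 3 * mG (3 * (Real.sqrt d * 2 ^ (-(n : ℤ)))) := by
  have hδ : 0 < Real.sqrt d * 2 ^ (-(n : ℤ)) := by
    have : (0:ℝ) < d := by exact_mod_cast hd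
    positivity
  obtain ⟨m, hM, hτT, hlt, hle, hosc, hoscT⟩ := exit_package d T _ hT hδ hδT S hS hScont
  have hτ0 : exitTimes d T (Real.sqrt d * 2 ^ (-(n : ℤ))) S 0 = 0 := by simp [exitTimes]
  obtain ⟨hg0, hgT, hglt, hgC⟩ := grid_package d n m hd T hT hδT _ hτ0 hτT hlt hle
  have hPi : hatPi d n T S = stepPath d T
      (gridTimes d n T (exitTimes d T (Real.sqrt d * 2 ^ (-(n : ℤ))) S) (m + 2)) (m + 2)
      (fun k => dyadicRound d (n + k) (S (exitTimes d T (Real.sqrt d * 2 ^ (-(n : ℤ))) S k)))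
      (dyadicRound d n (S T)) := by
    unfold hatPi stepPath
    simp only [hM]
  rw [hPi]
  have hround : ∀ k x, ‖x - dyadicRound d (n + k) x‖ ≤ Real.sqrt d * 2 ^ (-(n : ℤ)) := by
    intro k x
    refine (norm_sub_dyadicRound d (n + k) x).trans ?_
    refine mul_le_mul_of_nonneg_left ?_ (Real.sqrt_nonneg _)
    exact zpow_le_zpow_right₀ (by norm_num) (by push_cast; linarith)
  generalize gridTimes d n T (exitTimes d T (Real.sqrt d * 2 ^ (-(n : ℤ))) S) (m + 2) = τh at *
  generalize exitTimes d T (Real.sqrt d * 2 ^ (-(n : ℤ))) S = τ at *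
  generalize Real.sqrt d * 2 ^ (-(n : ℤ)) = δ at *
  have hglt' : ∀ k < m + 2, τh k < τh (k + 1) := fun k hk => hglt k (by omega)
  set B : ℝ → E d := stepPath d T τh (m + 2) (fun k => S (τ k)) (S (τ (m + 1))) with hBdef
  set P : ℝ → E d := stepPath d T τh (m + 2) (fun k => dyadicRound d (n + k) (S (τ k)))
    (dyadicRound d n (S T)) with hPdef
  have hSD : S ∈ DReal d T := ⟨hS, hScont, hS0⟩
  have hBD : B ∈ DReal d T := by
    refine stepPath_mem d T hT τh (m + 2) (by omega) _ _ hg0 hgT hglt ?_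
    intro i; simp only [hτ0]; exact hS0 i
  have hPD : P ∈ DReal d T := by
    refine stepPath_mem d T hT τh (m + 2) (by omega) _ _ hg0 hgT hglt ?_
    intro i; simp only [hτ0]; exact dyadicRound_one d _ _ hS0 i
  have hgm : τh (m + 2) < T := by rw [← hgT]; exact hglt (m + 2) (by omega)
  have hBP : skorokhodDist d T B P ≤ 3 * δ := by
    refine skorokhod_le d T hT B P _ id continuous_id strictMono_id rfl rfl ?_
    intro t ht
    simp only [id, sub_self, abs_zero, add_zero]
    rcases lt_or_ge t (τh (m + 2)) with h | h
    · obtain ⟨k, hk, hkt⟩ := exists_piece_Ico (m + 2) τh t (by rw [hg0]; exact ht.1) h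
      rw [hBdef, hPdef, stepPath_mid d T τh _ _ _ hglt' k hk t hkt,
        stepPath_mid d T τh _ _ _ hglt' k hk t hkt]
      have := hround k (S (τ k))
      linarith
    · rw [hBdef, hPdef, stepPath_last d T τh _ _ _ hglt' t ⟨h, ht.2⟩,
        stepPath_last d T τh _ _ _ hglt' t ⟨h, ht.2⟩]
      have h1 := hround 0 (S T)
      rw [norm_sub_rev] at hoscT
      have h2 := norm_sub_le_norm_sub_add_norm_sub (S (τ (m + 1))) (S T) (dyadicRound d n (S T))
      simp only [add_zero] at h1
      linarith
  have hSB : skorokhodDist d T S B ≤ 3 * δ := by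
    obtain ⟨l, hlc, hlm, hla, hlC⟩ := time_change (m + 2) τ (fun k => if k < m + 2 then τh k else T)
      (3 / 2 * δ) hlt
      (by
        intro k hk
        simp only [if_pos hk]
        split_ifs with h
        · exact hglt' k hk
        · exact (hglt' k hk).trans_le ((node_mono (m + 2) τh hglt' (k + 1) (m + 2) le_rfl hk).trans
            hgm.le))
      (by
        intro k hk
        split_ifs with h
        · exact hgC k h
        · obtain rfl : k = m + 2 := by omega
          rw [hτT, sub_self, abs_zero]; positivity)
    have hl0 : l 0 = 0 := by
      have := hla 0 (by omega)
      rwa [hτ0, if_pos (by omega), hg0] at this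
    have hlT : l T = T := by
      have := hla (m + 2) le_rfl
      rwa [hτT, if_neg (by omega)] at this
    refine skorokhod_le d T hT S B _ l hlc hlm hl0 hlT ?_
    intro t ht
    have hC := hlC t (by rw [hτ0, hτT]; exact ht)
    suffices h : ‖S t - B (l t)‖ ≤ δ by linarith
    rcases lt_or_ge t (τ (m + 1)) with h | h
    · obtain ⟨k, hk, hkt⟩ := exists_piece_Ico (m + 1) τ t (by rw [hτ0]; exact ht.1) h
      have e1 := hla k (by omega)
      have e2 := hla (k + 1) (by omega)
      rw [if_pos (by omega)] at e1 e2
      have hmem : l t ∈ Set.Ico (τh k) (τh (k + 1)) :=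
        ⟨e1 ▸ hlm.monotone hkt.1, e2 ▸ hlm hkt.2⟩
      rw [hBdef, stepPath_mid d T τh _ _ _ hglt' k (by omega) _ hmem]
      exact (hosc k (by omega) t hkt).le
    · have e1 := hla (m + 1) (by omega)
      rw [if_pos (by omega)] at e1
      have hge : τh (m + 1) ≤ l t := e1 ▸ hlm.monotone h
      have hleT : l t ≤ T := (hlm.monotone ht.2).trans hlT.le
      have hB : B (l t) = S (τ (m + 1)) := by
        rcases lt_or_ge (l t) (τh (m + 2)) with h' | h'
        · exact stepPath_mid d T τh _ _ _ hglt' (m + 1) (by omega) _ ⟨hge, h'⟩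
        · exact stepPath_last d T τh _ _ _ hglt' _ ⟨h', hleT⟩
      rw [hB]
      rcases eq_or_lt_of_le ht.2 with h' | h'
      · rw [h']; exact hoscT
      · exact (hosc (m + 1) (by omega) t ⟨h, by
          rw [show m + 1 + 1 = m + 2 from rfl, hτT]; exact h'⟩).le
  have h1 := (hGmod S B hSD hBD).trans (hmGmono (skorokhod_nonneg d T hT S B)
    (show (0:ℝ) ≤ 3 * δ by positivity) hSB)
  have h2 := (hGmod B P hBD hPD).trans (hmGmono (skorokhod_nonneg d T hT B P)
    (show (0:ℝ) ≤ 3 * δ by positivity) hBP)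
  have h3 := abs_sub_le (G S) (G B) (G P)
  have h4 := hmGnonneg (3 * δ)
  linarith


end
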